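/- arXiv:1904.07049 — 3 statements merged into one kernel-verified Lean document; each statement's English description precedes it below -/
import Mathlib

section
/- Let x ∈ V solve b(x,φ) = −α^{−1/2}⟨u_d, Iφ₁⟩_W for all φ ∈ V and let x̃_h ∈ V_h solve the perturbed discrete system b_h(x̃_h,φ_h) = −α^{−1/2}⟨u_d, Iφ_{h,1}⟩_W for all φ_h ∈ V_h. Then ‖x − x̃_h‖ ≤ κ̃_h·μ_h·( inf_{v_h ∈ V_h}‖x − v_h‖ + α^{−1/2}·sup over nonzero φ_h ∈ V_h of [⟨C_h*x₂, C_h*φ_{h,2}⟩_Q − ⟨C*x₂, C*φ_{h,2}⟩_Q]/‖φ_h‖_{α,h} ) ≤ 2·κ̃_h·μ_h·‖x − x̃_h‖, where x₂ denotes the second component of x. -/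
open scoped RealInnerProductSpace
open Filter Topology

noncomputable section Setup

variable {V₁ V₂ Q W : Type*}
  [NormedAddCommGroup V₁] [InnerProductSpace ℝ V₁]
  [NormedAddCommGroup V₂] [InnerProductSpace ℝ V₂]
  [NormedAddCommGroup Q] [InnerProductSpace ℝ Q]
  [NormedAddCommGroup W] [InnerProductSpace ℝ W]

/-- The ℓ²-norm on the product space `V = V₁ × V₂`. -/
def nV (v : V₁ × V₂) : ℝ := Real.sqrt (‖v.1‖ ^ 2 + ‖v.2‖ ^ 2)

/-- The seminorm `|v| = (‖I v₁‖² + ‖C* v₂‖²)^{1/2}`. -/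
def sV (Cs : V₂ →L[ℝ] Q) (Iop : V₁ →L[ℝ] W) (v : V₁ × V₂) : ℝ :=
  Real.sqrt (‖Iop v.1‖ ^ 2 + ‖Cs v.2‖ ^ 2)

/-- The vectorized bilinear form `a(v,φ) = a(v₁,φ₂) + a(φ₁,v₂)` on `V × V`. -/
def aV (a : V₁ →L[ℝ] V₂ →L[ℝ] ℝ) (v φ : V₁ × V₂) : ℝ := a v.1 φ.2 + a φ.1 v.2

/-- The bilinear form `b = a + α^{-1/2} c` of the rescaled reduced optimality system. -/
def bV (a : V₁ →L[ℝ] V₂ →L[ℝ] ℝ) (Cs : V₂ →L[ℝ] Q) (Iop : V₁ →L[ℝ] W) (α : ℝ)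
    (v φ : V₁ × V₂) : ℝ :=
  aV a v φ + (Real.sqrt α)⁻¹ * (⟪Cs v.2, Cs φ.2⟫ - ⟪Iop v.1, Iop φ.1⟫)

/-- Continuity constant `M_a = sup { a(v₁,v₂) : ‖v₁‖ = 1, ‖v₂‖ = 1 }`. -/
def contConst (a : V₁ →L[ℝ] V₂ →L[ℝ] ℝ) : ℝ :=
  sSup {r : ℝ | ∃ v₁ : V₁, ∃ v₂ : V₂, ‖v₁‖ = 1 ∧ ‖v₂‖ = 1 ∧ r = a v₁ v₂}

/-- Inf-sup constant `m_a = inf_{‖v₂‖=1} sup_{‖v₁‖=1} a(v₁,v₂)`. -/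
def infSupConst (a : V₁ →L[ℝ] V₂ →L[ℝ] ℝ) : ℝ :=
  sInf {r : ℝ | ∃ v₂ : V₂, ‖v₂‖ = 1 ∧
    r = sSup {s : ℝ | ∃ v₁ : V₁, ‖v₁‖ = 1 ∧ s = a v₁ v₂}}

/-- Discrete inf-sup constant of `a` on `V_{h,1} × V_{h,2}`. -/
def discInfSup (a : V₁ →L[ℝ] V₂ →L[ℝ] ℝ) (Vh1 : Submodule ℝ V₁)
    (Vh2 : Submodule ℝ V₂) : ℝ :=
  sInf {r : ℝ | ∃ v₁ ∈ Vh1, ‖v₁‖ = 1 ∧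
    r = sSup {s : ℝ | ∃ φ₂ ∈ Vh2, ‖φ₂‖ = 1 ∧ s = a v₁ φ₂}}

/-- Best approximation error `inf_{v_h ∈ V_h} ‖x - v_h‖` in the product norm. -/
def bestErr (Vh1 : Submodule ℝ V₁) (Vh2 : Submodule ℝ V₂) (x : V₁ × V₂) : ℝ :=
  sInf {r : ℝ | ∃ vh : V₁ × V₂, vh.1 ∈ Vh1 ∧ vh.2 ∈ Vh2 ∧ r = nV (x - vh)}

/-- The quasi-best-approximation constant `ν_h` of the Galerkin discretization of `b`:
`sup` over nonzero discrete test functions of the ratio of the continuous sup to the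
discrete sup. -/
def nuConst (a : V₁ →L[ℝ] V₂ →L[ℝ] ℝ) (Cs : V₂ →L[ℝ] Q) (Iop : V₁ →L[ℝ] W) (α : ℝ)
    (Vh1 : Submodule ℝ V₁) (Vh2 : Submodule ℝ V₂) : ℝ :=
  sSup {r : ℝ | ∃ φh : V₁ × V₂, φh.1 ∈ Vh1 ∧ φh.2 ∈ Vh2 ∧ φh ≠ 0 ∧
    r = sSup {s : ℝ | ∃ v : V₁ × V₂, nV v = 1 ∧ s = bV a Cs Iop α v φh} /
        sSup {s : ℝ | ∃ vh : V₁ × V₂, vh.1 ∈ Vh1 ∧ vh.2 ∈ Vh2 ∧ nV vh = 1 ∧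
          s = bV a Cs Iop α vh φh}}

/-- The nonlinear form `c_{K,α}` associated with the control constraint set `K`
(through its metric projection `PK`). -/
def cK (Cs : V₂ →L[ℝ] Q) (Iop : V₁ →L[ℝ] W) (PK : Q → Q) (α : ℝ) (v φ : V₁ × V₂) : ℝ :=
  -⟪PK ((-(Real.sqrt α)⁻¹) • (Cs v.2)), Cs φ.2⟫ - (Real.sqrt α)⁻¹ * ⟪Iop v.1, Iop φ.1⟫

/-- The nonlinear form `b_K = a + c_{K,α}`. -/
def bK (a : V₁ →L[ℝ] V₂ →L[ℝ] ℝ) (Cs : V₂ →L[ℝ] Q) (Iop : V₁ →L[ℝ] W) (PK : Q → Q)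
    (α : ℝ) (v φ : V₁ × V₂) : ℝ :=
  aV a v φ + cK Cs Iop PK α v φ

/-- The pseudometric `δ_{K,α}`. -/
def deltaK (Cs : V₂ →L[ℝ] Q) (Iop : V₁ →L[ℝ] W) (PK : Q → Q) (α : ℝ)
    (v w : V₁ × V₂) : ℝ :=
  Real.sqrt (α * ‖PK ((-(Real.sqrt α)⁻¹) • (Cs v.2)) -
      PK ((-(Real.sqrt α)⁻¹) • (Cs w.2))‖ ^ 2 + ‖Iop (v.1 - w.1)‖ ^ 2)

end Setup

/-- If `s • u + t • w ↦ s • u` is bounded by `B ≥ 1`, so is the complementary projection. -/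
theorem norm_complement_le {E : Type*} [NormedAddCommGroup E] [InnerProductSpace ℝ E]
    {u w : E} {B : ℝ} (hB : 1 ≤ B)
    (h : ∀ s t : ℝ, ‖s • u‖ ≤ B * ‖s • u + t • w‖) : ‖w‖ ≤ B * ‖u + w‖ := by
  rcases eq_or_ne u 0 with rfl | hu
  · rw [zero_add]
    nlinarith [norm_nonneg w]
  rcases eq_or_ne w 0 with rfl | hw
  · rw [norm_zero]
    positivity
  have hu' : 0 < ‖u‖ := norm_pos_iff.mpr hu
  have hw' : 0 < ‖w‖ := norm_pos_iff.mpr hw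
  have key := h (‖w‖ / ‖u‖) (‖u‖ / ‖w‖)
  have h1 : ‖(‖w‖ / ‖u‖) • u‖ = ‖w‖ := by
    rw [norm_smul, Real.norm_of_nonneg (by positivity)]
    field_simp
  have h2 : ‖(‖u‖ / ‖w‖) • w‖ = ‖u‖ := by
    rw [norm_smul, Real.norm_of_nonneg (by positivity)]
    field_simp
  have h3 : ‖(‖w‖ / ‖u‖) • u + (‖u‖ / ‖w‖) • w‖ = ‖u + w‖ := by
    rw [← sq_eq_sq₀ (norm_nonneg _) (norm_nonneg _), norm_add_sq_real, norm_add_sq_real, h1, h2,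
      real_inner_smul_left, real_inner_smul_right]
    field_simp
    ring
  rwa [h1, h3] at key

theorem mul_add_mul_le_sqrt_mul_sqrt (x₁ x₂ y₁ y₂ : ℝ) :
    x₁ * y₁ + x₂ * y₂ ≤ Real.sqrt (x₁ ^ 2 + x₂ ^ 2) * Real.sqrt (y₁ ^ 2 + y₂ ^ 2) := by
  rw [← Real.sqrt_mul (by positivity)]
  apply Real.le_sqrt_of_sq_le
  nlinarith [sq_nonneg (x₁ * y₂ - x₂ * y₁)]

/-- The scalar estimate behind the stability constant. -/
theorem stability_estimate {N p D L M μ β : ℝ} (hp : 0 ≤ p) (hD : 0 ≤ D)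
    (hM : 0 ≤ M) (hβ : 0 ≤ β) (hL : L = β * M) (hμ : 1 ≤ μ)
    (h₁ : β * p ^ 2 ≤ D * (N + L * p)) (h₂ : N ≤ μ * (D * (1 + L * M) + L * p)) :
    N ≤ ((1 + 2 * L) / (1 + L)) * (1 + M * μ * (1 + 2 * L)) * μ * D := by
  have hL0 : 0 ≤ L := by rw [hL]; positivity
  set K := L * M with hK
  have hK0 : 0 ≤ K := by positivity
  set s := L * p with hs
  have hs0 : 0 ≤ s := by positivity
  set m := M * μ with hm
  have hm0 : 0 ≤ m := by positivity
  set y := L * m with hy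
  have hy0 : 0 ≤ y := by positivity
  have hyK : y = K * μ := by rw [hy, hm, hK]; ring
  have hKy : K ≤ y := by rw [hyK]; nlinarith
  have e1 : s ^ 2 ≤ K * (D * (N + s)) := by
    have : s ^ 2 = K * (β * p ^ 2) := by rw [hs, hK, hL]; ring
    rw [this]
    exact mul_le_mul_of_nonneg_left h₁ hK0
  have e2 : s ^ 2 ≤ D * (y * D * (1 + y) + 2 * y * s) := by
    refine e1.trans ?_
    have : K * (N + s) ≤ y * D * (1 + y) + 2 * y * s := by
      have a1 : K * N ≤ y * (D * (1 + K) + s) := by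
        rw [hyK, mul_assoc K μ]
        exact mul_le_mul_of_nonneg_left h₂ hK0
      have a2 : K * s ≤ y * s := mul_le_mul_of_nonneg_right hKy hs0
      have a3 : y * D * K ≤ y * D * y := mul_le_mul_of_nonneg_left hKy (by positivity)
      nlinarith
    nlinarith [mul_le_mul_of_nonneg_left this hD]
  have e3 : (s - y * D) ^ 2 ≤ 4 * (y ^ 2 + y) * D ^ 2 := by
    have : 0 ≤ (2 * y ^ 2 + 3 * y) * D ^ 2 := by positivity
    nlinarith
  set P := m * (1 + 2 * L + 2 * L ^ 2) + L with hP
  have hP0 : 0 ≤ P := by positivity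
  have e4 : ((s - y * D) * (1 + L)) ^ 2 ≤ (P * D) ^ 2 := by
    have : P ^ 2 = 4 * (y ^ 2 + y) * (1 + L) ^ 2 + (m * (1 + 2 * L) - L) ^ 2 := by
      rw [hP, hy]; ring
    have h5 := mul_le_mul_of_nonneg_right e3 (sq_nonneg (1 + L))
    rw [mul_pow, mul_pow, this]
    nlinarith [mul_nonneg (sq_nonneg (m * (1 + 2 * L) - L)) (sq_nonneg D)]
  have e5 : (s - y * D) * (1 + L) ≤ P * D := abs_le_of_sq_le_sq' e4 (by positivity) |>.2
  have e6 : D * (1 + K) + s ≤ ((1 + 2 * L) / (1 + L)) * (1 + m * (1 + 2 * L)) * D := by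
    have : ((1 + 2 * L) / (1 + L)) * (1 + m * (1 + 2 * L)) * D =
        ((1 + 2 * L) * (1 + m * (1 + 2 * L)) * D) / (1 + L) := by ring
    rw [this, le_div_iff₀ (by positivity)]
    have a3 : D * K * (1 + L) ≤ D * y * (1 + L) := by gcongr
    have : (1 + 2 * L) * (1 + m * (1 + 2 * L)) * D = (1 + 2 * y) * D * (1 + L) + P * D := by
      rw [hP, hy]; ring
    rw [this]
    nlinarith
  calc N ≤ μ * (D * (1 + K) + s) := h₂
    _ ≤ μ * (((1 + 2 * L) / (1 + L)) * (1 + m * (1 + 2 * L)) * D) := by gcongr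
    _ = _ := by ring

section Forms

variable {V₁ V₂ Q W : Type*}
  [NormedAddCommGroup V₁] [InnerProductSpace ℝ V₁]
  [NormedAddCommGroup V₂] [InnerProductSpace ℝ V₂]
  [NormedAddCommGroup Q] [InnerProductSpace ℝ Q]
  [NormedAddCommGroup W] [InnerProductSpace ℝ W]

theorem nV_eq_norm_toLp (v : V₁ × V₂) : nV v = ‖WithLp.toLp 2 v‖ := by
  rw [WithLp.prod_norm_eq_of_L2]
  rfl

theorem nV_nonneg (v : V₁ × V₂) : 0 ≤ nV v := Real.sqrt_nonneg _

theorem nV_add_le (v w : V₁ × V₂) : nV (v + w) ≤ nV v + nV w := by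
  simp only [nV_eq_norm_toLp, WithLp.toLp_add]
  exact norm_add_le _ _

theorem nV_eq_zero {v : V₁ × V₂} : nV v = 0 ↔ v = 0 := by
  rw [nV_eq_norm_toLp, norm_eq_zero, WithLp.toLp_eq_zero]

theorem nV_pos {v : V₁ × V₂} (hv : v ≠ 0) : 0 < nV v :=
  (nV_nonneg v).lt_of_ne fun h => hv (nV_eq_zero.mp h.symm)

theorem nV_sq (v : V₁ × V₂) : nV v ^ 2 = ‖v.1‖ ^ 2 + ‖v.2‖ ^ 2 :=
  Real.sq_sqrt (by positivity)

theorem sV_nonneg (C : V₂ →L[ℝ] Q) (I : V₁ →L[ℝ] W) (v : V₁ × V₂) : 0 ≤ sV C I v :=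
  Real.sqrt_nonneg _

theorem sV_le (C : V₂ →L[ℝ] Q) (I : V₁ →L[ℝ] W) (v : V₁ × V₂) :
    sV C I v ≤ max ‖I‖ ‖C‖ * nV v := by
  have h1 : ‖I v.1‖ ≤ max ‖I‖ ‖C‖ * ‖v.1‖ :=
    (I.le_opNorm _).trans (mul_le_mul_of_nonneg_right (le_max_left _ _) (norm_nonneg _))
  have h2 : ‖C v.2‖ ≤ max ‖I‖ ‖C‖ * ‖v.2‖ :=
    (C.le_opNorm _).trans (mul_le_mul_of_nonneg_right (le_max_right _ _) (norm_nonneg _))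
  have hM : 0 ≤ max ‖I‖ ‖C‖ := (norm_nonneg _).trans (le_max_left _ _)
  refine Real.sqrt_le_iff.mpr ⟨mul_nonneg hM (nV_nonneg v), ?_⟩
  rw [mul_pow, nV_sq, mul_add, ← mul_pow, ← mul_pow]
  gcongr

theorem bV_add_left (a : V₁ →L[ℝ] V₂ →L[ℝ] ℝ) (C : V₂ →L[ℝ] Q) (I : V₁ →L[ℝ] W) (α : ℝ)
    (u v φ : V₁ × V₂) : bV a C I α (u + v) φ = bV a C I α u φ + bV a C I α v φ := by
  simp only [bV, aV, Prod.fst_add, Prod.snd_add, map_add, add_apply,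
    inner_add_left]
  ring

theorem bV_smul_left (a : V₁ →L[ℝ] V₂ →L[ℝ] ℝ) (C : V₂ →L[ℝ] Q) (I : V₁ →L[ℝ] W) (α : ℝ)
    (s : ℝ) (v φ : V₁ × V₂) : bV a C I α (s • v) φ = s * bV a C I α v φ := by
  simp only [bV, aV, Prod.smul_fst, Prod.smul_snd, map_smul, smul_apply,
    real_inner_smul_left, smul_eq_mul]
  ring

theorem bV_add_right (a : V₁ →L[ℝ] V₂ →L[ℝ] ℝ) (C : V₂ →L[ℝ] Q) (I : V₁ →L[ℝ] W) (α : ℝ)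
    (v φ ψ : V₁ × V₂) : bV a C I α v (φ + ψ) = bV a C I α v φ + bV a C I α v ψ := by
  simp only [bV, aV, Prod.fst_add, Prod.snd_add, map_add, add_apply,
    inner_add_right]
  ring

theorem bV_smul_right (a : V₁ →L[ℝ] V₂ →L[ℝ] ℝ) (C : V₂ →L[ℝ] Q) (I : V₁ →L[ℝ] W) (α : ℝ)
    (s : ℝ) (v φ : V₁ × V₂) : bV a C I α v (s • φ) = s * bV a C I α v φ := by
  simp only [bV, aV, Prod.smul_fst, Prod.smul_snd, map_smul, smul_apply,
    real_inner_smul_right, smul_eq_mul]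
  ring

theorem bV_sub_left (a : V₁ →L[ℝ] V₂ →L[ℝ] ℝ) (C : V₂ →L[ℝ] Q) (I : V₁ →L[ℝ] W) (α : ℝ)
    (u v φ : V₁ × V₂) : bV a C I α (u - v) φ = bV a C I α u φ - bV a C I α v φ := by
  rw [sub_eq_add_neg, ← neg_one_smul ℝ v, bV_add_left, bV_smul_left]
  ring

/-- With the adjoint norm on `V₂`, the form `a` has continuity constant at most one. -/
theorem apply_le_norm_mul_norm_of_adjoint_norm {a : V₁ →L[ℝ] V₂ →L[ℝ] ℝ}
    (hadj : ∀ v₂ : V₂, ‖v₂‖ = sSup {r : ℝ | ∃ φ₁ : V₁, ‖φ₁‖ = 1 ∧ r = a φ₁ v₂})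
    (v₁ : V₁) (v₂ : V₂) : a v₁ v₂ ≤ ‖v₁‖ * ‖v₂‖ := by
  rcases eq_or_ne v₁ 0 with rfl | h
  · simp
  have hpos : 0 < ‖v₁‖ := norm_pos_iff.mpr h
  have hbdd : BddAbove {r : ℝ | ∃ φ₁ : V₁, ‖φ₁‖ = 1 ∧ r = a φ₁ v₂} := by
    refine ⟨‖a‖ * ‖v₂‖, ?_⟩
    rintro r ⟨φ, hφ, rfl⟩
    have := a.le_opNorm₂ φ v₂
    rw [hφ, mul_one] at this
    exact (le_abs_self _).trans this
  have hle : a (‖v₁‖⁻¹ • v₁) v₂ ≤ ‖v₂‖ := by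
    rw [hadj v₂]
    refine le_csSup hbdd ⟨‖v₁‖⁻¹ • v₁, ?_, rfl⟩
    rw [norm_smul, norm_inv, norm_norm, inv_mul_cancel₀ hpos.ne']
  rw [map_smul, smul_apply, smul_eq_mul, inv_mul_le_iff₀ hpos] at hle
  exact hle

theorem inner_sub_inner_le (C : V₂ →L[ℝ] Q) (I : V₁ →L[ℝ] W) (v φ : V₁ × V₂) :
    ⟪C v.2, C φ.2⟫ - ⟪I v.1, I φ.1⟫ ≤ sV C I v * sV C I φ := by
  refine le_trans ?_ (mul_add_mul_le_sqrt_mul_sqrt _ _ _ _)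
  have h1 := real_inner_le_norm (C v.2) (C φ.2)
  have h2 := neg_le_of_abs_le (abs_real_inner_le_norm (I v.1) (I φ.1))
  linarith

theorem bV_le {a : V₁ →L[ℝ] V₂ →L[ℝ] ℝ} (ha : ∀ v₁ v₂, a v₁ v₂ ≤ ‖v₁‖ * ‖v₂‖)
    (C : V₂ →L[ℝ] Q) (I : V₁ →L[ℝ] W) (α : ℝ) (v φ : V₁ × V₂) :
    bV a C I α v φ ≤ nV v * (nV φ + max ‖I‖ ‖C‖ / Real.sqrt α * sV C I φ) := by
  have h1 : aV a v φ ≤ nV v * nV φ := by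
    have := mul_add_mul_le_sqrt_mul_sqrt ‖v.1‖ ‖v.2‖ ‖φ.2‖ ‖φ.1‖
    rw [add_comm (‖φ.2‖ ^ 2)] at this
    refine le_trans ?_ this
    have h3 := ha v.1 φ.2
    have h4 := ha φ.1 v.2
    rw [aV]
    linarith
  have hα : 0 ≤ (Real.sqrt α)⁻¹ := by positivity
  have h2 : ⟪C v.2, C φ.2⟫ - ⟪I v.1, I φ.1⟫ ≤ max ‖I‖ ‖C‖ * nV v * sV C I φ :=
    (inner_sub_inner_le C I v φ).trans
      (mul_le_mul_of_nonneg_right (sV_le C I v) (sV_nonneg C I φ))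
  calc bV a C I α v φ
      ≤ nV v * nV φ + (Real.sqrt α)⁻¹ * (max ‖I‖ ‖C‖ * nV v * sV C I φ) := by
        rw [bV]; gcongr
    _ = _ := by rw [div_eq_mul_inv]; ring

variable {a : V₁ →L[ℝ] V₂ →L[ℝ] ℝ} {Vh1 : Submodule ℝ V₁} {Vh2 : Submodule ℝ V₂} {μ : ℝ}

theorem exists_mem_ne_zero_of_discInfSup_pos (h : 0 < discInfSup a Vh1 Vh2) :
    ∃ v₁ ∈ Vh1, v₁ ≠ 0 := by
  by_contra! hc
  have : {r : ℝ | ∃ v₁ ∈ Vh1, ‖v₁‖ = 1 ∧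
      r = sSup {s : ℝ | ∃ φ₂ ∈ Vh2, ‖φ₂‖ = 1 ∧ s = a v₁ φ₂}} = ∅ := by
    refine Set.eq_empty_of_forall_notMem ?_
    rintro r ⟨v₁, hv, hn, -⟩
    rw [hc v₁ hv, norm_zero] at hn
    exact zero_ne_one hn
  rw [discInfSup, this, Real.sInf_empty] at h
  exact h.false

/-- The discrete inf-sup condition yields, for each trial function, a controlled test function. -/
theorem exists_test_snd [FiniteDimensional ℝ Vh2] (ha : ∀ v₁ v₂, a v₁ v₂ ≤ ‖v₁‖ * ‖v₂‖)
    (hμ : 0 < μ) (h : 1 / μ = discInfSup a Vh1 Vh2) (v₁ : V₁) (hv₁ : v₁ ∈ Vh1) :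
    ∃ φ₂ ∈ Vh2, a v₁ φ₂ = ‖v₁‖ ^ 2 ∧ ‖φ₂‖ ≤ μ * ‖v₁‖ := by
  rcases eq_or_ne v₁ 0 with rfl | hne
  · exact ⟨0, Vh2.zero_mem, by simp, by simp⟩
  have : CompleteSpace Vh2 := FiniteDimensional.complete ℝ Vh2
  have hpos : 0 < ‖v₁‖ := norm_pos_iff.mpr hne
  set g : Vh2 := (InnerProductSpace.toDual ℝ Vh2).symm ((a v₁).comp Vh2.subtypeL) with hg
  have hrep : ∀ φ ∈ Vh2, a v₁ φ = ⟪(g : V₂), φ⟫ := by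
    intro φ hφ
    have := InnerProductSpace.toDual_symm_apply (𝕜 := ℝ) (x := (⟨φ, hφ⟩ : Vh2))
      (y := (a v₁).comp Vh2.subtypeL)
    rw [← hg, Submodule.coe_inner] at this
    exact this.symm
  have hunit : ‖‖v₁‖⁻¹ • v₁‖ = 1 := by
    rw [norm_smul, norm_inv, norm_norm, inv_mul_cancel₀ hpos.ne']
  have hlow : 1 / μ ≤ sSup {s : ℝ | ∃ φ₂ ∈ Vh2, ‖φ₂‖ = 1 ∧ s = a (‖v₁‖⁻¹ • v₁) φ₂} := by
    rw [h]
    refine csInf_le ⟨-1, ?_⟩ ⟨_, Vh1.smul_mem _ hv₁, hunit, rfl⟩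
    rintro r ⟨w, -, hw, rfl⟩
    rcases Set.eq_empty_or_nonempty {s : ℝ | ∃ φ₂ ∈ Vh2, ‖φ₂‖ = 1 ∧ s = a w φ₂} with he | ⟨s, hs⟩
    · rw [he, Real.sSup_empty]
      norm_num
    · refine le_csSup_of_le ⟨1, ?_⟩ hs ?_
      · rintro s ⟨φ, -, hφ, rfl⟩
        simpa [hw, hφ] using ha w φ
      · obtain ⟨φ, -, hφ, rfl⟩ := hs
        have := ha (-w) φ
        simp only [map_neg, neg_apply, norm_neg, hw, hφ] at this
        linarith
  have hup : sSup {s : ℝ | ∃ φ₂ ∈ Vh2, ‖φ₂‖ = 1 ∧ s = a (‖v₁‖⁻¹ • v₁) φ₂} ≤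
      ‖v₁‖⁻¹ * ‖(g : V₂)‖ := by
    refine Real.sSup_le ?_ (by positivity)
    rintro s ⟨φ, hφm, hφ, rfl⟩
    rw [map_smul, smul_apply, smul_eq_mul, hrep φ hφm]
    have := real_inner_le_norm (g : V₂) φ
    rw [hφ, mul_one] at this
    gcongr
  have hgv : ‖v₁‖ ≤ μ * ‖(g : V₂)‖ := by
    have := hlow.trans hup
    rw [inv_mul_eq_div, div_le_div_iff₀ hμ hpos] at this
    linarith
  have hgpos : 0 < ‖(g : V₂)‖ := by
    by_contra! hc
    nlinarith
  refine ⟨(‖v₁‖ ^ 2 / ‖(g : V₂)‖ ^ 2) • (g : V₂), Vh2.smul_mem _ g.2, ?_, ?_⟩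
  · rw [map_smul, smul_eq_mul, hrep _ g.2, real_inner_self_eq_norm_sq]
    field_simp
  · rw [norm_smul, Real.norm_of_nonneg (by positivity)]
    have : ‖v₁‖ ^ 2 / ‖(g : V₂)‖ ^ 2 * ‖(g : V₂)‖ = ‖v₁‖ * ‖v₁‖ / ‖(g : V₂)‖ := by
      field_simp
    rw [this, div_le_iff₀ hgpos]
    nlinarith

theorem one_le_of_discInfSup [FiniteDimensional ℝ Vh2]
    (ha : ∀ v₁ v₂, a v₁ v₂ ≤ ‖v₁‖ * ‖v₂‖)
    (hμ : 0 < μ) (h : 1 / μ = discInfSup a Vh1 Vh2) : 1 ≤ μ := by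
  obtain ⟨v₁, hv₁, hne⟩ := exists_mem_ne_zero_of_discInfSup_pos (h ▸ one_div_pos.mpr hμ)
  obtain ⟨φ, -, h1, h2⟩ := exists_test_snd ha hμ h v₁ hv₁
  have hpos : 0 < ‖v₁‖ := norm_pos_iff.mpr hne
  have h3 : ‖v₁‖ ^ 2 ≤ ‖v₁‖ * (μ * ‖v₁‖) := by
    rw [← h1]
    exact (ha v₁ φ).trans (by gcongr)
  by_contra! hc
  nlinarith [mul_pos hpos hpos]

/-- The dual counterpart of `exists_test_snd`. -/
theorem exists_test_fst [FiniteDimensional ℝ Vh1] [FiniteDimensional ℝ Vh2]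
    (ha : ∀ v₁ v₂, a v₁ v₂ ≤ ‖v₁‖ * ‖v₂‖)
    (hndh2 : ∀ v₂ ∈ Vh2, (∀ φ₁ ∈ Vh1, a φ₁ v₂ = 0) → v₂ = 0)
    (hμ : 0 < μ) (h : 1 / μ = discInfSup a Vh1 Vh2) (v₂ : V₂) (hv₂ : v₂ ∈ Vh2) :
    ∃ φ₁ ∈ Vh1, a φ₁ v₂ = ‖v₂‖ ^ 2 ∧ ‖φ₁‖ ≤ μ * ‖v₂‖ := by
  let B : Vh1 →ₗ[ℝ] Vh2 →ₗ[ℝ] ℝ :=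
    LinearMap.mk₂ ℝ (fun u w => a u w) (by simp) (by simp) (by simp) (by simp)
  have hinj : Function.Injective B.flip := by
    rw [← LinearMap.ker_eq_bot, LinearMap.ker_eq_bot']
    intro w hw
    apply Subtype.ext
    exact hndh2 w w.2 fun φ hφ => LinearMap.congr_fun hw ⟨φ, hφ⟩
  have hsurj : Function.Surjective B := LinearMap.flip_injective_iff₁.mp hinj
  obtain ⟨φ, hφ⟩ := hsurj ((innerₗ V₂ v₂).comp Vh2.subtype)
  have hrep : ∀ ψ ∈ Vh2, a φ ψ = ⟪v₂, ψ⟫ := fun ψ hψ => LinearMap.congr_fun hφ ⟨ψ, hψ⟩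
  refine ⟨φ, φ.2, ?_, ?_⟩
  · rw [hrep v₂ hv₂, real_inner_self_eq_norm_sq]
  · obtain ⟨ψ, hψ, h1, h2⟩ := exists_test_snd ha hμ h φ φ.2
    rw [hrep ψ hψ] at h1
    have h3 : ‖(φ : V₁)‖ ^ 2 ≤ ‖v₂‖ * (μ * ‖(φ : V₁)‖) := by
      rw [← h1]
      exact (real_inner_le_norm _ _).trans (by gcongr)
    by_contra! hc
    have : 0 ≤ μ * ‖v₂‖ := by positivity
    nlinarith

/-- Stability of the perturbed discrete problem with respect to the `α`-dependent test norm. -/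
theorem nV_le_of_bV_le [FiniteDimensional ℝ Vh1] [FiniteDimensional ℝ Vh2]
    (ha : ∀ v₁ v₂, a v₁ v₂ ≤ ‖v₁‖ * ‖v₂‖)
    (hndh2 : ∀ v₂ ∈ Vh2, (∀ φ₁ ∈ Vh1, a φ₁ v₂ = 0) → v₂ = 0)
    (hμ : 0 < μ) (h : 1 / μ = discInfSup a Vh1 Vh2)
    (C : V₂ →L[ℝ] Q) (I : V₁ →L[ℝ] W) {α D L M : ℝ} (hM : M = max ‖I‖ ‖C‖)
    (hL : L = M / Real.sqrt α) (hD : 0 ≤ D)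
    {v : V₁ × V₂} (hv₁ : v.1 ∈ Vh1) (hv₂ : v.2 ∈ Vh2)
    (hb : ∀ φ : V₁ × V₂, φ.1 ∈ Vh1 → φ.2 ∈ Vh2 →
      bV a C I α v φ ≤ D * (nV φ + L * sV C I φ)) :
    nV v ≤ ((1 + 2 * L) / (1 + L)) * (1 + M * μ * (1 + 2 * L)) * μ * D := by
  have hM0 : 0 ≤ M := hM ▸ (norm_nonneg _).trans (le_max_left _ _)
  set β := (Real.sqrt α)⁻¹ with hβ
  have hβ0 : 0 ≤ β := by positivity
  have hLβ : L = β * M := by rw [hL, hβ]; ring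
  have hL0 : 0 ≤ L := by rw [hLβ]; positivity
  refine stability_estimate (sV_nonneg C I v) hD hM0 hβ0 hLβ
    (one_le_of_discInfSup ha hμ h) ?_ ?_
  · have := hb (-v.1, v.2) (Vh1.neg_mem hv₁) hv₂
    have e1 : nV (-v.1, v.2) = nV v := by simp [nV]
    have e2 : sV C I (-v.1, v.2) = sV C I v := by simp [sV]
    have e3 : bV a C I α v (-v.1, v.2) = β * sV C I v ^ 2 := by
      rw [sV, Real.sq_sqrt (by positivity), bV, aV]
      simp only [map_neg, neg_apply, inner_neg_right,
        real_inner_self_eq_norm_sq]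
      ring
    rwa [e1, e2, e3] at this
  · obtain ⟨φ₁, hφ₁, h1, h2⟩ := exists_test_fst ha hndh2 hμ h v.2 hv₂
    obtain ⟨φ₂, hφ₂, h3, h4⟩ := exists_test_snd ha hμ h v.1 hv₁
    have hn : nV (φ₁, φ₂) ≤ μ * nV v := by
      refine Real.sqrt_le_iff.mpr ⟨mul_nonneg hμ.le (nV_nonneg v), ?_⟩
      rw [mul_pow, nV_sq, mul_add, ← mul_pow, ← mul_pow, add_comm]
      gcongr
    have hs : sV C I (φ₁, φ₂) ≤ M * nV (φ₁, φ₂) := hM ▸ sV_le C I _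
    have hsv := sV_nonneg C I v
    have hnv := nV_nonneg v
    have key := hb (φ₁, φ₂) hφ₁ hφ₂
    have hc := inner_sub_inner_le C I v (-φ₁, -φ₂)
    have e2 : sV C I (-φ₁, -φ₂) = sV C I (φ₁, φ₂) := by simp [sV]
    rw [e2] at hc
    simp only [map_neg, inner_neg_right] at hc
    have hnv2 := nV_sq v
    simp only [bV, aV, h1, h3, ← hβ] at key
    have hc' := mul_le_mul_of_nonneg_left hc hβ0
    have k1 : nV v ^ 2 ≤
        D * (nV (φ₁, φ₂) + L * sV C I (φ₁, φ₂)) + β * (sV C I v * sV C I (φ₁, φ₂)) := by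
      linarith
    have k2 : nV v ^ 2 ≤ (μ * (D * (1 + L * M) + L * sV C I v)) * nV v :=
      calc nV v ^ 2 ≤ _ := k1
        _ ≤ D * (nV (φ₁, φ₂) + L * (M * nV (φ₁, φ₂))) +
            β * (sV C I v * (M * nV (φ₁, φ₂))) := by gcongr
        _ = (D * (1 + L * M) + L * sV C I v) * nV (φ₁, φ₂) := by rw [hLβ]; ring
        _ ≤ (D * (1 + L * M) + L * sV C I v) * (μ * nV v) := by gcongr
        _ = _ := by ring
    rcases hnv.eq_or_lt with h0 | h0
    · rw [← h0]
      positivity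
    · rw [sq] at k2
      exact le_of_mul_le_mul_right k2 h0

/-- Existence of the Galerkin projection for an injective discrete form. -/
theorem exists_galerkin [FiniteDimensional ℝ Vh1] [FiniteDimensional ℝ Vh2]
    (C : V₂ →L[ℝ] Q) (I : V₁ →L[ℝ] W) (α : ℝ)
    (hinj : ∀ v : V₁ × V₂, v.1 ∈ Vh1 → v.2 ∈ Vh2 →
      (∀ φ : V₁ × V₂, φ.1 ∈ Vh1 → φ.2 ∈ Vh2 → bV a C I α v φ = 0) → v = 0)
    (x : V₁ × V₂) :
    ∃ r : V₁ × V₂, r.1 ∈ Vh1 ∧ r.2 ∈ Vh2 ∧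
      ∀ φ : V₁ × V₂, φ.1 ∈ Vh1 → φ.2 ∈ Vh2 → bV a C I α r φ = bV a C I α x φ := by
  let ι : Vh1 × Vh2 →ₗ[ℝ] V₁ × V₂ := Vh1.subtype.prodMap Vh2.subtype
  let b : V₁ × V₂ →ₗ[ℝ] V₁ × V₂ →ₗ[ℝ] ℝ := LinearMap.mk₂ ℝ (bV a C I α)
    (bV_add_left a C I α) (bV_smul_left a C I α) (bV_add_right a C I α) (bV_smul_right a C I α)
  let T : Vh1 × Vh2 →ₗ[ℝ] Module.Dual ℝ (Vh1 × Vh2) := b.compl₁₂ ι ι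
  have hT : Function.Injective T := by
    rw [← LinearMap.ker_eq_bot, LinearMap.ker_eq_bot']
    intro u hu
    have h0 : ι u = 0 := hinj (ι u) u.1.2 u.2.2 fun φ h1 h2 =>
      LinearMap.congr_fun hu (⟨φ.1, h1⟩, ⟨φ.2, h2⟩)
    exact Prod.ext (Subtype.ext (congrArg Prod.fst h0)) (Subtype.ext (congrArg Prod.snd h0))
  have hsurj : Function.Surjective T :=
    (LinearMap.injective_iff_surjective_of_finrank_eq_finrank
      (Subspace.dual_finrank_eq (K := ℝ)).symm).mp hT
  obtain ⟨u, hu⟩ := hsurj ((b x).comp ι)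
  exact ⟨ι u, u.1.2, u.2.2, fun φ h1 h2 => LinearMap.congr_fun hu (⟨φ.1, h1⟩, ⟨φ.2, h2⟩)⟩

end Forms

/-- Lemma 4.2, approximation and consistency error for an approximate
control-action operator: the error of the perturbed variational discretization is
equivalent, up to the factor `κ̃_h μ_h`, to best error plus consistency error. -/
theorem stmt9
    {V₁ V₂ Q W : Type*}
    [NormedAddCommGroup V₁] [InnerProductSpace ℝ V₁] [CompleteSpace V₁] [Nontrivial V₁]
    [NormedAddCommGroup V₂] [InnerProductSpace ℝ V₂] [CompleteSpace V₂] [Nontrivial V₂]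
    [NormedAddCommGroup Q] [InnerProductSpace ℝ Q] [CompleteSpace Q]
    [NormedAddCommGroup W] [InnerProductSpace ℝ W] [CompleteSpace W]
    (a : V₁ →L[ℝ] V₂ →L[ℝ] ℝ) (Cs Ch : V₂ →L[ℝ] Q) (Iop : V₁ →L[ℝ] W)
    (α m_a M_I M_Ch Mth Lth : ℝ) (hα : 0 < α)
    (hma : m_a = infSupConst a) (hma_pos : 0 < m_a)
    (hnd : ∀ v₁ : V₁, (∀ v₂ : V₂, a v₁ v₂ = 0) → v₁ = 0)
    (hadj : ∀ v₂ : V₂, ‖v₂‖ = sSup {r : ℝ | ∃ φ₁ : V₁, ‖φ₁‖ = 1 ∧ r = a φ₁ v₂})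
    (hMI : M_I = ‖Iop‖) (hMCh : M_Ch = ‖Ch‖) (hMth : Mth = max M_I M_Ch)
    (hLth : Lth = Mth / Real.sqrt α)
    (Vh1 : Submodule ℝ V₁) (Vh2 : Submodule ℝ V₂)
    [FiniteDimensional ℝ Vh1] [FiniteDimensional ℝ Vh2]
    (hndh1 : ∀ v₁ ∈ Vh1, (∀ φ₂ ∈ Vh2, a v₁ φ₂ = 0) → v₁ = 0)
    (hndh2 : ∀ v₂ ∈ Vh2, (∀ φ₁ ∈ Vh1, a φ₁ v₂ = 0) → v₂ = 0)
    (μh κth : ℝ) (hμh_pos : 0 < μh)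
    (hμh : 1 / μh = discInfSup a Vh1 Vh2)
    (hκth : κth = ((1 + 2 * Lth) / (1 + Lth)) *
      (1 + Mth * μh * (1 + 2 * Mth / Real.sqrt α)))
    (u_d : W) (x xth : V₁ × V₂)
    (hx : ∀ φ : V₁ × V₂, bV a Cs Iop α x φ = -(Real.sqrt α)⁻¹ * ⟪u_d, Iop φ.1⟫)
    (hxth_mem : xth.1 ∈ Vh1 ∧ xth.2 ∈ Vh2)
    (hxth : ∀ φh : V₁ × V₂, φh.1 ∈ Vh1 → φh.2 ∈ Vh2 →
      bV a Ch Iop α xth φh = -(Real.sqrt α)⁻¹ * ⟪u_d, Iop φh.1⟫) :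
    nV (x - xth) ≤ κth * μh * (bestErr Vh1 Vh2 x + (Real.sqrt α)⁻¹ *
        sSup {r : ℝ | ∃ φh : V₁ × V₂, φh.1 ∈ Vh1 ∧ φh.2 ∈ Vh2 ∧ φh ≠ 0 ∧
          r = (⟪Ch x.2, Ch φh.2⟫ - ⟪Cs x.2, Cs φh.2⟫) /
            (nV φh + (Mth / Real.sqrt α) * sV Ch Iop φh)}) ∧
    κth * μh * (bestErr Vh1 Vh2 x + (Real.sqrt α)⁻¹ *
        sSup {r : ℝ | ∃ φh : V₁ × V₂, φh.1 ∈ Vh1 ∧ φh.2 ∈ Vh2 ∧ φh ≠ 0 ∧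
          r = (⟪Ch x.2, Ch φh.2⟫ - ⟪Cs x.2, Cs φh.2⟫) /
            (nV φh + (Mth / Real.sqrt α) * sV Ch Iop φh)}) ≤
      2 * κth * μh * nV (x - xth) := by
  have ha := apply_le_norm_mul_norm_of_adjoint_norm hadj
  have hM : Mth = max ‖Iop‖ ‖Ch‖ := by rw [hMth, hMI, hMCh]
  have hM0 : 0 ≤ Mth := hM ▸ (norm_nonneg _).trans (le_max_left _ _)
  have hL0 : 0 ≤ Lth := by rw [hLth]; positivity
  have hμ1 : 1 ≤ μh := one_le_of_discInfSup ha hμh_pos hμh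
  have hκ : κth = ((1 + 2 * Lth) / (1 + Lth)) * (1 + Mth * μh * (1 + 2 * Lth)) := by
    rw [hκth, hLth, mul_div_assoc]
  have hκ1 : 1 ≤ κth := by
    rw [hκ]
    refine one_le_mul_of_one_le_of_one_le ?_ ?_
    · rw [one_le_div (by positivity)]
      linarith
    · have : 0 ≤ Mth * μh * (1 + 2 * Lth) := by positivity
      linarith
  have hB1 : 1 ≤ κth * μh := one_le_mul_of_one_le_of_one_le hκ1 hμ1
  have hB0 : 0 ≤ κth * μh := zero_le_one.trans hB1
  rw [← hLth]
  set β := (Real.sqrt α)⁻¹ with hβ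
  have hβpos : 0 < β := inv_pos.mpr (Real.sqrt_pos.mpr hα)
  have stab : ∀ (D : ℝ), 0 ≤ D → ∀ v : V₁ × V₂, v.1 ∈ Vh1 → v.2 ∈ Vh2 →
      (∀ φ : V₁ × V₂, φ.1 ∈ Vh1 → φ.2 ∈ Vh2 →
        bV a Ch Iop α v φ ≤ D * (nV φ + Lth * sV Ch Iop φ)) → nV v ≤ κth * μh * D := by
    intro D hD v h1 h2 hb
    rw [hκ]
    exact nV_le_of_bV_le ha hndh2 hμh_pos hμh Ch Iop hM hLth hD h1 h2 hb
  have bound : ∀ v φ : V₁ × V₂,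
      bV a Ch Iop α v φ ≤ nV v * (nV φ + Lth * sV Ch Iop φ) := by
    intro v φ
    have := bV_le ha Ch Iop α v φ
    rwa [← hM, ← hLth] at this
  have den_pos : ∀ φ : V₁ × V₂, φ ≠ 0 → 0 < nV φ + Lth * sV Ch Iop φ := fun φ hφ =>
    add_pos_of_pos_of_nonneg (nV_pos hφ) (mul_nonneg hL0 (sV_nonneg _ _ _))
  have cons : ∀ φ : V₁ × V₂, φ.1 ∈ Vh1 → φ.2 ∈ Vh2 →
      bV a Ch Iop α (x - xth) φ = β * (⟪Ch x.2, Ch φ.2⟫ - ⟪Cs x.2, Cs φ.2⟫) := by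
    intro φ h1 h2
    rw [bV_sub_left, hxth φ h1 h2, ← hx φ]
    simp only [bV, ← hβ]
    ring
  set S := {r : ℝ | ∃ φh : V₁ × V₂, φh.1 ∈ Vh1 ∧ φh.2 ∈ Vh2 ∧ φh ≠ 0 ∧
          r = (⟪Ch x.2, Ch φh.2⟫ - ⟪Cs x.2, Cs φh.2⟫) /
            (nV φh + Lth * sV Ch Iop φh)} with hS
  have hS_le : ∀ r ∈ S, r ≤ β⁻¹ * nV (x - xth) := by
    rintro r ⟨φ, h1, h2, hφ, rfl⟩
    rw [div_le_iff₀ (den_pos φ hφ), mul_assoc, ← div_eq_inv_mul, le_div_iff₀ hβpos, mul_comm,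
      ← cons φ h1 h2]
    exact bound _ _
  have hSbdd : BddAbove S := ⟨_, hS_le⟩
  have hcons_le : ∀ φ : V₁ × V₂, φ.1 ∈ Vh1 → φ.2 ∈ Vh2 →
      bV a Ch Iop α (x - xth) φ ≤ (β * sSup S) * (nV φ + Lth * sV Ch Iop φ) := by
    intro φ h1 h2
    rw [cons φ h1 h2, mul_assoc]
    refine mul_le_mul_of_nonneg_left ?_ hβpos.le
    rcases eq_or_ne φ 0 with rfl | hφ
    · simp [nV, sV]
    · rw [← div_le_iff₀ (den_pos φ hφ)]
      exact le_csSup hSbdd ⟨φ, h1, h2, hφ, rfl⟩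
  have hS0 : 0 ≤ sSup S := by
    obtain ⟨v₁, hv₁, hne⟩ :=
      exists_mem_ne_zero_of_discInfSup_pos (hμh ▸ one_div_pos.mpr hμh_pos)
    refine le_csSup hSbdd ⟨(v₁, 0), hv₁, Vh2.zero_mem, ?_, by simp⟩
    simpa [Prod.ext_iff] using hne
  refine ⟨?_, ?_⟩
  · obtain ⟨r, hr1, hr2, hr⟩ := exists_galerkin (a := a) (Vh1 := Vh1) (Vh2 := Vh2) Ch Iop α
      (fun v h1 h2 h0 => by
        have := stab 0 le_rfl v h1 h2 fun φ h3 h4 => by rw [h0 φ h3 h4, zero_mul]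
        rw [mul_zero] at this
        exact nV_eq_zero.mp (this.antisymm (nV_nonneg v))) x
    have hr0 : ∀ φ : V₁ × V₂, φ.1 ∈ Vh1 → φ.2 ∈ Vh2 → bV a Ch Iop α (x - r) φ = 0 :=
      fun φ h1 h2 => by rw [bV_sub_left, hr φ h1 h2, sub_self]
    have hdisc : nV (r - xth) ≤ κth * μh * (β * sSup S) := by
      refine stab _ (by positivity) _ (Vh1.sub_mem hr1 hxth_mem.1)
        (Vh2.sub_mem hr2 hxth_mem.2) fun φ h1 h2 => ?_
      rw [bV_sub_left, hr φ h1 h2, ← bV_sub_left]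
      exact hcons_le φ h1 h2
    have hproj : ∀ vh : V₁ × V₂, vh.1 ∈ Vh1 → vh.2 ∈ Vh2 →
        nV (x - r) ≤ κth * μh * nV (x - vh) := by
      intro vh h1 h2
      have hsum : x - vh = (r - vh) + (x - r) := by abel
      rw [hsum]
      simp only [nV_eq_norm_toLp, WithLp.toLp_add]
      refine norm_complement_le hB1 fun s t => ?_
      rw [← WithLp.toLp_smul, ← WithLp.toLp_smul, ← WithLp.toLp_add, ← nV_eq_norm_toLp,
        ← nV_eq_norm_toLp]
      refine stab _ (nV_nonneg _) _ (Vh1.smul_mem s (Vh1.sub_mem hr1 h1))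
        (Vh2.smul_mem s (Vh2.sub_mem hr2 h2)) fun φ h3 h4 => ?_
      have := bound (s • (r - vh) + t • (x - r)) φ
      rwa [bV_add_left, bV_smul_left a Ch Iop α t, hr0 φ h3 h4, mul_zero, add_zero] at this
    have hbest : nV (x - r) ≤ κth * μh * bestErr Vh1 Vh2 x := by
      rw [mul_comm, ← div_le_iff₀ (zero_lt_one.trans_le hB1)]
      refine le_csInf ⟨_, xth, hxth_mem.1, hxth_mem.2, rfl⟩ ?_
      rintro e ⟨vh, h1, h2, rfl⟩
      rw [div_le_iff₀ (zero_lt_one.trans_le hB1), mul_comm]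
      exact hproj vh h1 h2
    calc nV (x - xth) = nV ((x - r) + (r - xth)) := by rw [sub_add_sub_cancel]
      _ ≤ nV (x - r) + nV (r - xth) := nV_add_le _ _
      _ ≤ κth * μh * bestErr Vh1 Vh2 x + κth * μh * (β * sSup S) := add_le_add hbest hdisc
      _ = _ := by ring
  · have hE : bestErr Vh1 Vh2 x ≤ nV (x - xth) := by
      refine csInf_le ⟨0, ?_⟩ ⟨xth, hxth_mem.1, hxth_mem.2, rfl⟩
      rintro e ⟨vh, -, -, rfl⟩
      exact nV_nonneg _
    have hC : β * sSup S ≤ nV (x - xth) := by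
      rw [← le_inv_mul_iff₀ hβpos]
      exact Real.sSup_le hS_le (mul_nonneg (inv_nonneg.mpr hβpos.le) (nV_nonneg _))
    calc κth * μh * (bestErr Vh1 Vh2 x + β * sSup S)
        ≤ κth * μh * (nV (x - xth) + nV (x - xth)) := by gcongr
      _ = _ := by ring
end

section
/- Suppose the approximate variational discretization is quasi-best for all right-hand sides: there exists ν ≥ 0 such that for every bounded linear functional f on V, any x ∈ V with b(x,φ) = f(φ) for all φ ∈ V and any x̃_h ∈ V_h with b_h(x̃_h,φ_h) = f(φ_h) for all φ_h ∈ V_h satisfy ‖x − x̃_h‖ ≤ ν·inf_{v_h ∈ V_h}‖x − v_h‖. Then ‖C_h* v_{h,2}‖_Q = ‖C* v_{h,2}‖_Q for every v_{h,2} ∈ V_{h,2}. -/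
open scoped RealInnerProductSpace
open Filter Topology

theorem eq_zero_of_nV_nonpos {E F : Type*} [NormedAddCommGroup E] [NormedAddCommGroup F]
    {v : E × F} (h : nV v ≤ 0) : v = 0 := by
  have h0 := Real.sqrt_eq_zero'.mp (le_antisymm h (Real.sqrt_nonneg _))
  have h1 : ‖v.1‖ ^ 2 = 0 := by nlinarith [sq_nonneg ‖v.1‖, sq_nonneg ‖v.2‖]
  have h2 : ‖v.2‖ ^ 2 = 0 := by nlinarith [sq_nonneg ‖v.1‖, sq_nonneg ‖v.2‖]
  exact Prod.ext (by simpa using h1) (by simpa using h2)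

section Galerkin

variable {V₁ V₂ Q W : Type*}
  [NormedAddCommGroup V₁] [InnerProductSpace ℝ V₁]
  [NormedAddCommGroup V₂] [InnerProductSpace ℝ V₂]
  [NormedAddCommGroup Q] [InnerProductSpace ℝ Q]
  [NormedAddCommGroup W] [InnerProductSpace ℝ W]

/-- The form `bV` as a bilinear map on `V₁ × V₂`. -/
noncomputable def bVLin (a : V₁ →L[ℝ] V₂ →L[ℝ] ℝ) (Cs : V₂ →L[ℝ] Q) (Iop : V₁ →L[ℝ] W) (α : ℝ) :
    (V₁ × V₂) →ₗ[ℝ] (V₁ × V₂) →ₗ[ℝ] ℝ :=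
  LinearMap.mk₂ ℝ (bV a Cs Iop α)
    (by intros; simp [bV, aV, inner_add_left]; ring)
    (by intros; simp [bV, aV, real_inner_smul_left]; ring)
    (by intros; simp [bV, aV, inner_add_right]; ring)
    (by intros; simp [bV, aV, real_inner_smul_right]; ring)

/-- The functional `bV(x, ·)` is bounded. -/
theorem exists_clm_eq_bV (a : V₁ →L[ℝ] V₂ →L[ℝ] ℝ) (Cs : V₂ →L[ℝ] Q) (Iop : V₁ →L[ℝ] W) (α : ℝ)
    (x : V₁ × V₂) : ∃ f : (V₁ × V₂) →L[ℝ] ℝ, ∀ φ, bV a Cs Iop α x φ = f φ :=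
  ⟨⟨bVLin a Cs Iop α x, by
    change Continuous fun φ => bV a Cs Iop α x φ
    unfold bV aV
    fun_prop⟩, fun _ => rfl⟩

/-- If `bV(v, ·)` vanishes on the discrete space, then so does `v`. -/
theorem eq_zero_of_bV_eq_zero (a : V₁ →L[ℝ] V₂ →L[ℝ] ℝ) (Cs : V₂ →L[ℝ] Q) (Iop : V₁ →L[ℝ] W)
    {α : ℝ} (hα : 0 < α) (Vh1 : Submodule ℝ V₁) (Vh2 : Submodule ℝ V₂)
    (hndh1 : ∀ v₁ ∈ Vh1, (∀ φ₂ ∈ Vh2, a v₁ φ₂ = 0) → v₁ = 0)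
    (hndh2 : ∀ v₂ ∈ Vh2, (∀ φ₁ ∈ Vh1, a φ₁ v₂ = 0) → v₂ = 0)
    {v : V₁ × V₂} (hv1 : v.1 ∈ Vh1) (hv2 : v.2 ∈ Vh2)
    (h : ∀ φ : V₁ × V₂, φ.1 ∈ Vh1 → φ.2 ∈ Vh2 → bV a Cs Iop α v φ = 0) : v = 0 := by
  have hs : 0 < (Real.sqrt α)⁻¹ := inv_pos.mpr (Real.sqrt_pos.mpr hα)
  have hsum : ‖Cs v.2‖ ^ 2 + ‖Iop v.1‖ ^ 2 = 0 := by
    have h0 := h (-v.1, v.2) (Vh1.neg_mem hv1) hv2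
    simp only [bV, aV, map_neg, inner_neg_right, real_inner_self_eq_norm_sq,
      neg_apply, add_neg_cancel, zero_add, sub_neg_eq_add] at h0
    exact (mul_eq_zero.mp h0).resolve_left hs.ne'
  have hC : Cs v.2 = 0 := by
    have : ‖Cs v.2‖ ^ 2 = 0 := by nlinarith [sq_nonneg ‖Cs v.2‖, sq_nonneg ‖Iop v.1‖]
    simpa using this
  have hI : Iop v.1 = 0 := by
    have : ‖Iop v.1‖ ^ 2 = 0 := by nlinarith [sq_nonneg ‖Cs v.2‖, sq_nonneg ‖Iop v.1‖]
    simpa using this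
  refine Prod.ext (hndh1 _ hv1 fun φ₂ hφ => ?_) (hndh2 _ hv2 fun φ₁ hφ => ?_)
  · simpa [bV, aV, hC, hI] using h (0, φ₂) Vh1.zero_mem hφ
  · simpa [bV, aV, hC, hI] using h (φ₁, 0) hφ Vh2.zero_mem

/-- The discrete problem is solvable for every linear right-hand side. -/
theorem exists_discrete_solution (a : V₁ →L[ℝ] V₂ →L[ℝ] ℝ) (Cs : V₂ →L[ℝ] Q)
    (Iop : V₁ →L[ℝ] W) {α : ℝ} (hα : 0 < α) (Vh1 : Submodule ℝ V₁) (Vh2 : Submodule ℝ V₂)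
    [FiniteDimensional ℝ Vh1] [FiniteDimensional ℝ Vh2]
    (hndh1 : ∀ v₁ ∈ Vh1, (∀ φ₂ ∈ Vh2, a v₁ φ₂ = 0) → v₁ = 0)
    (hndh2 : ∀ v₂ ∈ Vh2, (∀ φ₁ ∈ Vh1, a φ₁ v₂ = 0) → v₂ = 0)
    (f : (V₁ × V₂) →ₗ[ℝ] ℝ) :
    ∃ x : V₁ × V₂, x.1 ∈ Vh1 ∧ x.2 ∈ Vh2 ∧
      ∀ φ : V₁ × V₂, φ.1 ∈ Vh1 → φ.2 ∈ Vh2 → bV a Cs Iop α x φ = f φ := by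
  let J : (Vh1 × Vh2) →ₗ[ℝ] V₁ × V₂ := Vh1.subtype.prodMap Vh2.subtype
  let T : (Vh1 × Vh2) →ₗ[ℝ] Module.Dual ℝ (Vh1 × Vh2) := (bVLin a Cs Iop α).compl₁₂ J J
  have hinj : Function.Injective T := by
    refine (injective_iff_map_eq_zero T).mpr fun v hv => ?_
    have h0 : J v = 0 :=
      eq_zero_of_bV_eq_zero a Cs Iop hα Vh1 Vh2 hndh1 hndh2 v.1.2 v.2.2
        fun φ h1 h2 => LinearMap.congr_fun hv (⟨φ.1, h1⟩, ⟨φ.2, h2⟩)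
    exact Prod.ext (Subtype.ext (congrArg Prod.fst h0)) (Subtype.ext (congrArg Prod.snd h0))
  have hsurj : Function.Surjective T :=
    (LinearMap.injective_iff_surjective_of_finrank_eq_finrank
      Subspace.dual_finrank_eq.symm).mp hinj
  obtain ⟨x, hx⟩ := hsurj (f ∘ₗ J)
  exact ⟨J x, x.1.2, x.2.2, fun φ h1 h2 => LinearMap.congr_fun hx (⟨φ.1, h1⟩, ⟨φ.2, h2⟩)⟩

theorem bestErr_nonpos {Vh1 : Submodule ℝ V₁} {Vh2 : Submodule ℝ V₂} {x : V₁ × V₂}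
    (h1 : x.1 ∈ Vh1) (h2 : x.2 ∈ Vh2) : bestErr Vh1 Vh2 x ≤ 0 := by
  refine csInf_le ⟨0, ?_⟩ ⟨x, h1, h2, by simp [nV]⟩
  rintro r ⟨vh, -, -, rfl⟩
  exact Real.sqrt_nonneg _

end Galerkin

/-- Corollary 4.3, necessary condition for quasi-best approximation:
if the approximate variational discretization is quasi-best for all right-hand sides,
then `‖C_h* v_{h,2}‖ = ‖C* v_{h,2}‖` on `V_{h,2}`. -/
theorem stmt10
    {V₁ V₂ Q W : Type*}
    [NormedAddCommGroup V₁] [InnerProductSpace ℝ V₁] [CompleteSpace V₁] [Nontrivial V₁]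
    [NormedAddCommGroup V₂] [InnerProductSpace ℝ V₂] [CompleteSpace V₂] [Nontrivial V₂]
    [NormedAddCommGroup Q] [InnerProductSpace ℝ Q] [CompleteSpace Q]
    [NormedAddCommGroup W] [InnerProductSpace ℝ W] [CompleteSpace W]
    (a : V₁ →L[ℝ] V₂ →L[ℝ] ℝ) (Cs Ch : V₂ →L[ℝ] Q) (Iop : V₁ →L[ℝ] W)
    (α m_a : ℝ) (hα : 0 < α)
    (hma : m_a = infSupConst a) (hma_pos : 0 < m_a)
    (hnd : ∀ v₁ : V₁, (∀ v₂ : V₂, a v₁ v₂ = 0) → v₁ = 0)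
    (Vh1 : Submodule ℝ V₁) (Vh2 : Submodule ℝ V₂)
    [FiniteDimensional ℝ Vh1] [FiniteDimensional ℝ Vh2]
    (hndh1 : ∀ v₁ ∈ Vh1, (∀ φ₂ ∈ Vh2, a v₁ φ₂ = 0) → v₁ = 0)
    (hndh2 : ∀ v₂ ∈ Vh2, (∀ φ₁ ∈ Vh1, a φ₁ v₂ = 0) → v₂ = 0)
    -- quasi-best approximation for every bounded linear right-hand side
    (ν : ℝ) (hν : 0 ≤ ν)
    (hqb : ∀ f : (V₁ × V₂) →L[ℝ] ℝ, ∀ x : V₁ × V₂,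
      (∀ φ : V₁ × V₂, bV a Cs Iop α x φ = f φ) →
      ∀ xth : V₁ × V₂, xth.1 ∈ Vh1 → xth.2 ∈ Vh2 →
        (∀ φh : V₁ × V₂, φh.1 ∈ Vh1 → φh.2 ∈ Vh2 → bV a Ch Iop α xth φh = f φh) →
        nV (x - xth) ≤ ν * bestErr Vh1 Vh2 x) :
    ∀ vh2 ∈ Vh2, ‖Ch vh2‖ = ‖Cs vh2‖ := by
  intro vh2 hvh2
  obtain ⟨f, hf⟩ := exists_clm_eq_bV a Cs Iop α ((0, vh2) : V₁ × V₂)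
  obtain ⟨y, hy1, hy2, hy⟩ :=
    exists_discrete_solution a Ch Iop hα Vh1 Vh2 hndh1 hndh2 f.toLinearMap
  have hle := (hqb f _ hf y hy1 hy2 hy).trans
    (mul_nonpos_of_nonneg_of_nonpos hν (bestErr_nonpos Vh1.zero_mem hvh2))
  obtain rfl : ((0, vh2) : V₁ × V₂) = y := sub_eq_zero.mp (eq_zero_of_nV_nonpos hle)
  have h := (hy (0, vh2) Vh1.zero_mem hvh2).trans (hf (0, vh2)).symm
  have hs : (Real.sqrt α)⁻¹ ≠ 0 := (inv_pos.mpr (Real.sqrt_pos.mpr hα)).ne'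
  simp only [bV, aV, real_inner_self_eq_norm_sq, add_right_inj, mul_right_inj' hs,
    sub_left_inj] at h
  exact (sq_eq_sq₀ (norm_nonneg _) (norm_nonneg _)).mp h
end

section
/- For every u_d ∈ W there exists a unique x ∈ V such that b_K(x,φ) = −α^{−1/2}·⟨u_d, Iφ₁⟩_W for all φ = (φ₁,φ₂) ∈ V (unique solvability of the rescaled and reduced optimality system with control constraints). -/
open scoped RealInnerProductSpace
open Filter Topology

theorem infSupConst_mul_norm_le
    {V₁ V₂ : Type*} [NormedAddCommGroup V₁] [InnerProductSpace ℝ V₁]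
    [NormedAddCommGroup V₂] [InnerProductSpace ℝ V₂]
    (a : V₁ →L[ℝ] V₂ →L[ℝ] ℝ) (hpos : 0 < infSupConst a) (v₂ : V₂) :
    infSupConst a * ‖v₂‖ ≤ ‖a.flip v₂‖ := by
  have unit : ∀ w : V₂, ‖w‖ = 1 → infSupConst a ≤ ‖a.flip w‖ := by
    intro w hw
    have hbdd : BddBelow {r : ℝ | ∃ v₂ : V₂, ‖v₂‖ = 1 ∧
        r = sSup {s : ℝ | ∃ v₁ : V₁, ‖v₁‖ = 1 ∧ s = a v₁ v₂}} := by
      by_contra h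
      rw [infSupConst, Real.sInf_of_not_bddBelow h] at hpos
      exact lt_irrefl _ hpos
    refine (csInf_le hbdd ⟨w, hw, rfl⟩).trans (Real.sSup_le ?_ (norm_nonneg _))
    rintro s ⟨v₁, hv₁, rfl⟩
    simpa [hv₁] using (le_abs_self _).trans ((a.flip w).le_opNorm v₁)
  rcases eq_or_ne v₂ 0 with rfl | hv
  · simp
  have hn : 0 < ‖v₂‖ := norm_pos_iff.mpr hv
  have h := unit (‖v₂‖⁻¹ • v₂) (by simp [norm_smul, hn.ne'])
  rw [map_smul, norm_smul, norm_inv, norm_norm, ← div_eq_inv_mul, le_div_iff₀ hn] at h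
  exact h

/-- A bounded bilinear form with positive inf-sup constant, nondegenerate in its first argument,
is represented by an isomorphism. -/
theorem exists_continuousLinearEquiv_inner_eq
    {V₁ V₂ : Type*} [NormedAddCommGroup V₁] [InnerProductSpace ℝ V₁] [CompleteSpace V₁]
    [NormedAddCommGroup V₂] [InnerProductSpace ℝ V₂] [CompleteSpace V₂]
    (a : V₁ →L[ℝ] V₂ →L[ℝ] ℝ) (hpos : 0 < infSupConst a)
    (hnd : ∀ v₁ : V₁, (∀ v₂ : V₂, a v₁ v₂ = 0) → v₁ = 0) :
    ∃ T : V₂ ≃L[ℝ] V₁, ∀ v₁ v₂, ⟪T v₂, v₁⟫ = a v₁ v₂ := by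
  let T₀ : V₂ →L[ℝ] V₁ := LinearMap.mkContinuous
    { toFun := fun v => (InnerProductSpace.toDual ℝ V₁).symm (a.flip v)
      map_add' := by simp
      map_smul' := by simp }
    ‖a.flip‖ (fun v => by simpa using a.flip.le_opNorm v)
  have hT₀ : ∀ v₁ v₂, ⟪T₀ v₂, v₁⟫ = a v₁ v₂ := fun v₁ v₂ =>
    InnerProductSpace.toDual_symm_apply (𝕜 := ℝ) (x := v₁) (y := a.flip v₂)
  have hnorm : ∀ v, ‖T₀ v‖ = ‖a.flip v‖ := fun v =>
    (InnerProductSpace.toDual ℝ V₁).symm.norm_map (a.flip v)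
  have hanti : AntilipschitzWith (Real.toNNReal (infSupConst a)⁻¹) T₀ := by
    refine T₀.antilipschitz_of_bound fun v => ?_
    rw [Real.coe_toNNReal _ (inv_nonneg.mpr hpos.le), hnorm, ← div_eq_inv_mul, le_div_iff₀ hpos,
      mul_comm]
    exact infSupConst_mul_norm_le a hpos v
  have hclosed : IsClosed (T₀.range : Set V₁) := by
    rw [LinearMap.coe_range]
    exact hanti.isClosed_range T₀.uniformContinuous
  have : CompleteSpace T₀.range := hclosed.completeSpace_coe
  have hrange : T₀.range = ⊤ := by
    rw [← Submodule.orthogonal_eq_bot_iff, Submodule.eq_bot_iff]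
    intro v hv
    refine hnd v fun w => ?_
    rw [← hT₀]
    exact (Submodule.mem_orthogonal _ _).mp hv _ ⟨w, rfl⟩
  exact ⟨.ofBijective T₀ (LinearMap.ker_eq_bot.mpr hanti.injective) hrange, hT₀⟩

theorem eq_metricProjection_iff
    {Q : Type*} [NormedAddCommGroup Q] [InnerProductSpace ℝ Q]
    {K : Set Q} (hK_cx : Convex ℝ K) {PK : Q → Q} (hPK_mem : ∀ q, PK q ∈ K)
    (hPK : ∀ q : Q, ∀ p ∈ K, ‖q - PK q‖ ≤ ‖q - p‖) (q p : Q) :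
    p = PK q ↔ p ∈ K ∧ ∀ k ∈ K, ⟪q - p, k - p⟫ ≤ 0 := by
  have hproj : ∀ k ∈ K, ⟪q - PK q, k - PK q⟫ ≤ 0 := by
    have : Nonempty K := ⟨⟨_, hPK_mem q⟩⟩
    refine (norm_eq_iInf_iff_real_inner_le_zero hK_cx (hPK_mem q)).mp (le_antisymm ?_ ?_)
    · exact le_ciInf fun k => hPK q k k.2
    · exact ciInf_le (f := fun k : K => ‖q - k‖)
        ⟨0, by rintro _ ⟨k, rfl⟩; exact norm_nonneg _⟩ ⟨_, hPK_mem q⟩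
  constructor
  · rintro rfl
    exact ⟨hPK_mem q, hproj⟩
  · rintro ⟨hp, h⟩
    have h₁ := h _ (hPK_mem q)
    have h₂ := hproj p hp
    have hsum : ⟪PK q - p, PK q - p⟫ = ⟪q - p, PK q - p⟫ + ⟪q - PK q, p - PK q⟫ := by
      simp only [inner_sub_left, inner_sub_right, real_inner_comm]
      ring
    have h₀ : ⟪PK q - p, PK q - p⟫ ≤ 0 := by linarith
    exact (sub_eq_zero.mp (real_inner_self_nonpos.mp h₀)).symm

/-- The first-order optimality condition of `min_{p ∈ K} ‖p‖² + ‖S p - w‖²` has exactly one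
solution. -/
theorem existsUnique_regularizedLeastSquares
    {Q W : Type*} [NormedAddCommGroup Q] [InnerProductSpace ℝ Q] [CompleteSpace Q]
    [NormedAddCommGroup W] [InnerProductSpace ℝ W] [CompleteSpace W]
    (S : Q →L[ℝ] W) (w : W) {K : Set Q} (hK_ne : K.Nonempty) (hK_cl : IsClosed K)
    (hK_cx : Convex ℝ K) :
    ∃! p : Q, p ∈ K ∧ ∀ k ∈ K, -⟪p, k - p⟫ + ⟪w - S p, S (k - p)⟫ ≤ 0 := by
  refine existsUnique_of_exists_of_unique ?_ ?_
  · let G : Set (WithLp 2 (Q × W)) := {z | z.fst ∈ K ∧ z.snd = S z.fst}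
    have hG_cl : IsClosed G := by
      refine (hK_cl.preimage (by fun_prop)).inter (isClosed_eq ?_ ?_) <;> fun_prop
    have hG_cx : Convex ℝ G := by
      rintro x ⟨hx, hx'⟩ y ⟨hy, hy'⟩ s t hs ht hst
      exact ⟨hK_cx hx hy hs ht hst, by simp [hx', hy']⟩
    obtain ⟨k₀, hk₀⟩ := hK_ne
    have hG_ne : G.Nonempty := ⟨WithLp.toLp 2 (k₀, S k₀), hk₀, rfl⟩
    obtain ⟨z, hz, hmin⟩ := exists_norm_eq_iInf_of_complete_convex hG_ne hG_cl.isComplete hG_cx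
      (WithLp.toLp 2 (0, w))
    have hvi := (norm_eq_iInf_iff_real_inner_le_zero hG_cx hz).mp hmin
    refine ⟨z.fst, hz.1, fun k hk => ?_⟩
    have h := hvi (WithLp.toLp 2 (k, S k)) ⟨hk, rfl⟩
    rw [WithLp.prod_inner_apply] at h
    simpa [hz.2] using h
  · rintro p p' ⟨hp, h⟩ ⟨hp', h'⟩
    have h₁ := h p' hp'
    have h₂ := h' p hp
    have hsum : -⟪p, p' - p⟫ + ⟪w - S p, S (p' - p)⟫
        + (-⟪p', p - p'⟫ + ⟪w - S p', S (p - p')⟫)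
        = ⟪p - p', p - p'⟫ + ⟪S (p - p'), S (p - p')⟫ := by
      simp only [map_sub, inner_sub_left, inner_sub_right, real_inner_comm]
      ring
    have hS : 0 ≤ ⟪S (p - p'), S (p - p')⟫ := real_inner_self_nonneg
    have h₀ : ⟪p - p', p - p'⟫ ≤ 0 := by linarith
    exact sub_eq_zero.mp (real_inner_self_nonpos.mp h₀)

/-- The reduced optimality system, split into its state and adjoint equations. -/
theorem forall_bK_eq_iff
    {V₁ V₂ Q W : Type*}
    [NormedAddCommGroup V₁] [InnerProductSpace ℝ V₁] [CompleteSpace V₁]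
    [NormedAddCommGroup V₂] [InnerProductSpace ℝ V₂]
    [NormedAddCommGroup Q] [InnerProductSpace ℝ Q] [CompleteSpace Q]
    [NormedAddCommGroup W] [InnerProductSpace ℝ W] [CompleteSpace W]
    {a : V₁ →L[ℝ] V₂ →L[ℝ] ℝ} {T : V₂ ≃L[ℝ] V₁} (hT : ∀ v₁ v₂, ⟪T v₂, v₁⟫ = a v₁ v₂)
    (Cs : V₂ →L[ℝ] Q) (Iop : V₁ →L[ℝ] W) (PK : Q → Q) (α : ℝ) (u : W) (x : V₁ × V₂) :
    (∀ φ : V₁ × V₂, bK a Cs Iop PK α x φ = -(Real.sqrt α)⁻¹ * ⟪u, Iop φ.1⟫) ↔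
      x.1 = (Cs ∘L (T.symm : V₁ →L[ℝ] V₂)).adjoint (PK ((-(Real.sqrt α)⁻¹) • Cs x.2)) ∧
      x.2 = T.symm ((Real.sqrt α)⁻¹ • Iop.adjoint (Iop x.1 - u)) := by
  set s := (Real.sqrt α)⁻¹
  set p := PK (-s • Cs x.2)
  have hB : ∀ v, ⟪(Cs ∘L (T.symm : V₁ →L[ℝ] V₂)).adjoint p, v⟫ = ⟪p, Cs (T.symm v)⟫ := fun v => by
    rw [ContinuousLinearMap.adjoint_inner_left]; rfl
  have hI : ∀ v, ⟪s • Iop.adjoint (Iop x.1 - u), v⟫ = s * (⟪Iop x.1, Iop v⟫ - ⟪u, Iop v⟫) :=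
    fun v => by
      rw [real_inner_smul_left, ContinuousLinearMap.adjoint_inner_left, inner_sub_left]
  have hb : ∀ φ : V₁ × V₂, bK a Cs Iop PK α x φ =
      ⟪x.1, T φ.2⟫ + ⟪T x.2, φ.1⟫ + (-⟪p, Cs φ.2⟫ - s * ⟪Iop x.1, Iop φ.1⟫) := fun φ => by
    rw [hT, real_inner_comm, hT]; rfl
  constructor
  · intro h
    constructor
    · refine ext_inner_right ℝ fun v => ?_
      have := h (0, T.symm v)
      rw [hb] at this
      simp at this
      rw [hB]
      linarith
    · rw [ContinuousLinearEquiv.eq_symm_apply]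
      refine ext_inner_right ℝ fun v => ?_
      have := h (v, 0)
      rw [hb] at this
      simp at this
      rw [hI]
      linarith
  · rintro ⟨h₁, h₂⟩ φ
    rw [ContinuousLinearEquiv.eq_symm_apply] at h₂
    have e₁ : ⟪x.1, T φ.2⟫ = ⟪p, Cs φ.2⟫ := by
      conv_lhs => rw [h₁]
      rw [hB, T.symm_apply_apply]
    rw [hb, e₁, h₂, hI]
    ring

/-- Corollary 5.2, well-posedness with control constraints: the
rescaled and reduced optimality system with convex control constraints has a unique
solution for every desired state. -/
theorem stmt14
    {V₁ V₂ Q W : Type*}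
    [NormedAddCommGroup V₁] [InnerProductSpace ℝ V₁] [CompleteSpace V₁] [Nontrivial V₁]
    [NormedAddCommGroup V₂] [InnerProductSpace ℝ V₂] [CompleteSpace V₂] [Nontrivial V₂]
    [NormedAddCommGroup Q] [InnerProductSpace ℝ Q] [CompleteSpace Q]
    [NormedAddCommGroup W] [InnerProductSpace ℝ W] [CompleteSpace W]
    (a : V₁ →L[ℝ] V₂ →L[ℝ] ℝ) (Cs : V₂ →L[ℝ] Q) (Iop : V₁ →L[ℝ] W)
    (α m_a : ℝ) (hα : 0 < α)
    (hma : m_a = infSupConst a) (hma_pos : 0 < m_a)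
    (hnd : ∀ v₁ : V₁, (∀ v₂ : V₂, a v₁ v₂ = 0) → v₁ = 0)
    (K : Set Q) (hK_ne : K.Nonempty) (hK_cl : IsClosed K) (hK_cx : Convex ℝ K)
    (PK : Q → Q) (hPK_mem : ∀ q, PK q ∈ K)
    (hPK : ∀ q : Q, ∀ p ∈ K, ‖q - PK q‖ ≤ ‖q - p‖) :
    ∀ u_d : W, ∃! x : V₁ × V₂, ∀ φ : V₁ × V₂,
      bK a Cs Iop PK α x φ = -(Real.sqrt α)⁻¹ * ⟪u_d, Iop φ.1⟫ := by
  intro u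
  obtain ⟨T, hT⟩ := exists_continuousLinearEquiv_inner_eq a (hma ▸ hma_pos) hnd
  simp only [forall_bK_eq_iff hT]
  set s := (Real.sqrt α)⁻¹
  set B : V₁ →L[ℝ] Q := Cs ∘L (T.symm : V₁ →L[ℝ] V₂)
  let adj : Q → V₂ := fun p => T.symm (s • Iop.adjoint (Iop (B.adjoint p) - u))
  have hfix : ∀ p, p = PK (-s • Cs (adj p)) ↔ p ∈ K ∧ ∀ k ∈ K,
      -⟪p, k - p⟫ + ⟪s • u - (s • Iop ∘L B.adjoint) p, (s • Iop ∘L B.adjoint) (k - p)⟫ ≤ 0 := by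
    intro p
    rw [eq_metricProjection_iff hK_cx hPK_mem hPK]
    refine and_congr_right fun _ => forall₂_congr fun k _ => ?_
    have hadj : Cs (adj p) = s • B (Iop.adjoint (Iop (B.adjoint p) - u)) := by
      rw [← map_smul]; rfl
    have e : ⟪-s • Cs (adj p) - p, k - p⟫ = -⟪p, k - p⟫ +
        ⟪s • u - (s • Iop ∘L B.adjoint) p, (s • Iop ∘L B.adjoint) (k - p)⟫ := by
      rw [hadj, inner_sub_left, real_inner_smul_left, real_inner_smul_left,
        ← ContinuousLinearMap.adjoint_inner_right, ContinuousLinearMap.adjoint_inner_left]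
      simp only [smul_apply, ContinuousLinearMap.comp_apply,
        ← smul_sub, real_inner_smul_left, real_inner_smul_right, inner_sub_left]
      ring
    rw [e]
  obtain ⟨p, hp, huniq⟩ := existsUnique_regularizedLeastSquares (s • Iop ∘L B.adjoint) (s • u)
    hK_ne hK_cl hK_cx
  have hp' := (hfix p).mpr hp
  refine ⟨(B.adjoint p, adj p), ⟨congrArg B.adjoint hp', rfl⟩, ?_⟩
  rintro ⟨x₁, x₂⟩ ⟨h₁, h₂⟩
  dsimp only at h₁ h₂
  have hx₂ : x₂ = adj (PK (-s • Cs x₂)) := by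
    conv_lhs => rw [h₂, h₁]
  have hq : PK (-s • Cs x₂) = p := huniq _ ((hfix _).mp (by rw [← hx₂]))
  rw [hq] at h₁ hx₂
  rw [h₁, hx₂]
end
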